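/- Let (p_j)_{j≥0} be a log-concave sequence of positive reals with f(z) = ∑ p_j z^j entire and lim_{r→∞} ln f(r)/(ln r)² = β ∈ (0,∞). Then lim_{j→∞} (ln p_j)/j² = -1/(4β). -/

import Mathlib

open Filter

lemma slope_max (L d : ℕ → ℝ) (hd : ∀ j, d j = L j - L (j+1)) (hm : Monotone d) (j k : ℕ) :
    L k + k * d j ≤ L j + j * d j := by
  rcases le_total j k with h | h
  · induction k, h using Nat.le_induction with
    | base => exact le_rfl
    | succ k hk ih =>
      have := hm hk
      have := hd k
      push_cast
      linarith
  · obtain ⟨n, rfl⟩ := Nat.exists_eq_add_of_le h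
    clear h
    have key : ∀ n k : ℕ, ∀ D, d (k + n) ≤ D → L k + k * D ≤ L (k+n) + ((k+n : ℕ) : ℝ) * D := by
      intro n
      induction n with
      | zero => intro k D _; simp
      | succ n ih =>
        intro k D hD
        have h1 : d (k + n) ≤ D := (hm (by omega)).trans hD
        have h2 := ih k D h1
        have h3 := hd (k + n)
        rw [← add_assoc]
        push_cast at h2 ⊢
        linarith
    exact key n k _ le_rfl

/-- If `(p_j)` is positive log-concave, `f(z) = ∑ p_j z^j` is entire and
`lim_{r→∞} ln f(r)/(ln r)² = β ∈ (0,∞)`, then `lim_{j→∞} (ln p_j)/j² = -1/(4β)`. -/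
theorem coeff_limit (p : ℕ → ℝ) (hp : ∀ j, 0 < p j)
    (hlc : ∀ j : ℕ, 1 ≤ j → p (j - 1) * p (j + 1) ≤ (p j) ^ 2)
    (hent : ∀ r : ℝ, 0 < r → Summable (fun j : ℕ => p j * r ^ j))
    (β : ℝ) (hβ : 0 < β)
    (hlim : Tendsto (fun r : ℝ => Real.log (∑' j : ℕ, p j * r ^ j) / (Real.log r) ^ 2)
      atTop (nhds β)) :
    Tendsto (fun j : ℕ => Real.log (p j) / (j : ℝ) ^ 2) atTop (nhds (-1 / (4 * β))) := by
  have hF := hlim.comp Real.tendsto_exp_atTop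
  simp only [Function.comp_def, Real.log_exp] at hF
  set f : ℝ → ℝ := fun s => ∑' j : ℕ, p j * Real.exp s ^ j with hf
  have hterm : ∀ k : ℕ, ∀ s : ℝ, p k * Real.exp s ^ k = Real.exp (Real.log (p k) + k * s) := by
    intro k s
    rw [Real.exp_add, Real.exp_log (hp k), Real.exp_nat_mul]
  have hfge : ∀ (j : ℕ) (s : ℝ), Real.exp (Real.log (p j) + j * s) ≤ f s := by
    intro j s
    rw [← hterm]
    exact (hent _ (Real.exp_pos s)).le_tsum j
      (fun k _ => mul_nonneg (hp k).le (pow_nonneg (Real.exp_pos s).le _))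
  have hfpos : ∀ s, 0 < f s := fun s => (Real.exp_pos _).trans_le (hfge 0 s)
  -- the slopes
  obtain ⟨d, hd⟩ : ∃ d : ℕ → ℝ, ∀ j, d j = Real.log (p j) - Real.log (p (j+1)) := ⟨_, fun _ => rfl⟩
  have hm : Monotone d := by
    refine monotone_nat_of_le_succ fun n => ?_
    have h := hlc (n+1) (by omega)
    have h' := Real.log_le_log (mul_pos (hp _) (hp _)) h
    rw [Real.log_mul (hp _).ne' (hp _).ne', Real.log_pow] at h'
    simp only [Nat.add_sub_cancel] at h'
    push_cast at h'
    rw [hd, hd]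
    linarith
  have hmax := slope_max (fun j => Real.log (p j)) d hd hm
  have hdtop : Tendsto d atTop atTop := by
    refine tendsto_atTop_atTop_of_monotone hm ?_
    by_contra! hcon
    obtain ⟨D, hD⟩ := hcon
    have h0 := (hent _ (Real.exp_pos D)).tendsto_atTop_zero
    have hlow : ∀ k : ℕ, p 0 ≤ p k * Real.exp D ^ k := by
      intro k
      induction k with
      | zero => simp
      | succ k ih =>
        refine ih.trans ?_
        rw [hterm, hterm]
        apply Real.exp_le_exp.2
        have := hd k
        have := hD k
        push_cast
        linarith
    have := ge_of_tendsto' h0 hlow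
    linarith [hp 0]
  have hC : Summable (fun k : ℕ => Real.exp (-(k:ℝ))) := Real.summable_exp_neg_nat
  obtain ⟨C, hCdef⟩ : ∃ C, C = ∑' k : ℕ, Real.exp (-(k:ℝ)) := ⟨_, rfl⟩
  have hCpos : 0 < C := by
    rw [hCdef]; exact hC.tsum_pos (fun _ => (Real.exp_pos _).le) 0 (Real.exp_pos _)
  have hfle : ∀ j : ℕ, Real.log (f (d j - 1)) ≤ Real.log (p j) + j * d j + Real.log C := by
    intro j
    have h1 : f (d j - 1) ≤ Real.exp (Real.log (p j) + j * d j) * C := by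
      rw [hCdef, ← tsum_mul_left]
      refine (hent _ (Real.exp_pos _)).tsum_le_tsum (fun k => ?_) (hC.mul_left _)
      rw [hterm, ← Real.exp_add]
      apply Real.exp_le_exp.2
      have := hmax j k
      linarith
    have h2 := Real.log_le_log (hfpos _) h1
    rwa [Real.log_mul (Real.exp_pos _).ne' hCpos.ne', Real.log_exp] at h2
  have hjtop : Tendsto (fun j : ℕ => (j:ℝ)) atTop atTop := tendsto_natCast_atTop_atTop
  have hL : -1 / (4 * β) < 0 := div_neg_of_neg_of_pos (by norm_num) (by positivity)
  refine tendsto_order.2 ⟨fun a ha => ?_, fun a ha => ?_⟩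
  · obtain ⟨m, ham, hm1⟩ := exists_between ha
    have hm0 : m < 0 := hm1.trans hL
    obtain ⟨b, hb⟩ : ∃ b, b = -1 / (4 * m) := ⟨_, rfl⟩
    have hbm : 4 * b * m = -1 := by have := hm0.ne; rw [hb]; field_simp
    have hbpos : 0 < b := by
      rw [hb]; exact div_pos_of_neg_of_neg (by norm_num) (by linarith)
    have hbβ : b < β := by
      rw [lt_div_iff₀ (by positivity)] at hm1
      nlinarith
    have hev := (hdtop.eventually_ge_atTop 2)
    have hev2 := (tendsto_atTop_add_const_right _ (-1 : ℝ) hdtop).eventually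
      (hF.eventually_const_lt hbβ)
    have hev3 := hjtop.eventually_ge_atTop ((1 + |Real.log C|) / (m - a) + 1)
    filter_upwards [hev, hev2, hev3] with j h1 h2 h3
    have hma : 0 < m - a := by linarith
    have hj1 : (1:ℝ) ≤ j := by
      have : 0 ≤ (1 + |Real.log C|) / (m - a) := by positivity
      linarith
    have h4 : (1 + |Real.log C|) < j * (m - a) := by
      rw [← div_lt_iff₀ hma]; linarith
    have h5 := hfle j
    rw [← sub_eq_add_neg, lt_div_iff₀ (by nlinarith)] at h2
    rw [lt_div_iff₀ (by positivity)]
    have h6 : m * j^2 ≤ b * (d j - 1)^2 - j * (d j - 1) := by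
      have : b * (d j - 1)^2 - j * (d j - 1) - m * j^2 = b * ((d j - 1) + 2 * m * j)^2
          - (1 + 4 * b * m) * (j * (d j - 1)+ m * j^2) := by ring
      rw [hbm] at this
      have := mul_nonneg hbpos.le (sq_nonneg ((d j - 1) + 2 * m * j))
      linarith
    have h7 := le_abs_self (Real.log C)
    have h8 := abs_nonneg (Real.log C)
    change _ < Real.log (f (d j - 1)) at h2
    have h9 : (1 + |Real.log C|) * j ≤ (m - a) * j^2 := by nlinarith
    have h10 : |Real.log C| ≤ |Real.log C| * j := le_mul_of_one_le_right h8 hj1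
    have h11 : (1 + |Real.log C|) * j < (m - a) * j^2 := by nlinarith
    linarith
  · obtain ⟨m, hm1, ham⟩ := exists_between (lt_min ha hL)
    obtain ⟨ham, hm0⟩ := lt_min_iff.1 ham
    obtain ⟨b, hb⟩ : ∃ b, b = -1 / (4 * m) := ⟨_, rfl⟩
    have hbm : 4 * b * m = -1 := by have := hm0.ne; rw [hb]; field_simp
    have hbpos : 0 < b := by
      rw [hb]; exact div_pos_of_neg_of_neg (by norm_num) (by linarith)
    have hbβ : β < b := by
      rw [div_lt_iff₀ (by positivity)] at hm1
      nlinarith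
    have hs : Tendsto (fun j : ℕ => (j:ℝ) * (-2 * m)) atTop atTop :=
      hjtop.atTop_mul_const (by linarith)
    have hev2 := hs.eventually (hF.eventually_lt_const hbβ)
    filter_upwards [hev2, hjtop.eventually_ge_atTop 1] with j h2 h3
    have hspos : 0 < (j:ℝ) * (-2 * m) := mul_pos (by linarith) (by linarith)
    rw [div_lt_iff₀ (by positivity)] at h2
    rw [div_lt_iff₀ (by positivity)]
    have h5 := Real.log_le_log (Real.exp_pos _) (hfge j ((j:ℝ) * (-2 * m)))
    rw [Real.log_exp] at h5
    change Real.log (f _) < _ at h2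
    have h6 : b * ((j:ℝ) * (-2 * m))^2 = - m * j^2 := by
      linear_combination (m * j^2) * hbm
    have h7 : m * (j:ℝ)^2 < a * j^2 := mul_lt_mul_of_pos_right ham (by positivity)
    nlinarith
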